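/- arXiv:0909.5289 — 2 statements merged into one kernel-verified Lean document; each statement's English description precedes it below -/
import Mathlib

section
/- (Remark 3(iii)) Let U and W be nondegenerate random variables and let c ∈ ℝ be a constant such that P(UW = c) = 1. Then the distribution of (U, W) on ℝ² is decomposable if and only if there exist b₁, b₂ ≠ 0 with b₁² − 4 c b₁ b₂⁻¹ > 0 and α, β ∈ (0,1) such that, with a₁ = (b₁ + √(b₁² − 4 c b₁ b₂⁻¹))/2 and a₂ = (b₁ − √(b₁² − 4 c b₁ b₂⁻¹))/2, one has P{(U,W) = x} = αβ if x = (a₁, a₂ b₁⁻¹ b₂); = (1−α)β if x = (a₂, a₁ b₁⁻¹ b₂); = α(1−β) if x = (−a₂, −a₁ b₁⁻¹ b₂); and = (1−α)(1−β) if x = (−a₁, −a₂ b₁⁻¹ b₂). -/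
open MeasureTheory ProbabilityTheory

/-- A distribution is degenerate if it is a one-point mass. -/
def IsDegenerate {E : Type*} [MeasurableSpace E] (μ : Measure E) : Prop :=
  ∃ x : E, μ = Measure.dirac x

/-- A probability distribution `μ` is decomposable if it is the convolution of two
nondegenerate probability distributions; otherwise it is indecomposable. -/
def Decomposable {E : Type*} [MeasurableSpace E] [AddMonoid E] (μ : Measure E) : Prop :=
  ∃ μ₁ μ₂ : Measure E, IsProbabilityMeasure μ₁ ∧ IsProbabilityMeasure μ₂ ∧
    ¬ IsDegenerate μ₁ ∧ ¬ IsDegenerate μ₂ ∧ μ = μ₁.conv μ₂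

open scoped ENNReal

section TwoPointMeasures

variable {E : Type*} [MeasurableSpace E]

theorem isDegenerate_of_ae_eq {μ : Measure E} [IsProbabilityMeasure μ] {x : E}
    (h : ∀ᵐ y ∂μ, y = x) : IsDegenerate μ :=
  ⟨x, by simpa using (Measure.map_congr (f := id) (g := fun _ => x) h)⟩

theorem isDegenerate_map_of_ae_eq {Ω : Type*} [MeasurableSpace Ω] {P : Measure Ω}
    [IsProbabilityMeasure P] {X : Ω → E} {x : E} (h : ∀ᵐ ω ∂P, X ω = x) :
    IsDegenerate (P.map X) :=
  ⟨x, by simpa using (Measure.map_congr (f := X) (g := fun _ => x) h)⟩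

/-- A property that holds almost surely for a nondegenerate law holds at two distinct points. -/
theorem exists_ne_of_ae {μ : Measure E} [IsProbabilityMeasure μ] (hμ : ¬ IsDegenerate μ)
    {p : E → Prop} (h : ∀ᵐ x ∂μ, p x) : ∃ x y, x ≠ y ∧ p x ∧ p y := by
  obtain ⟨x, hx⟩ := h.exists
  by_contra! hne
  refine hμ (isDegenerate_of_ae_eq (x := x) ?_)
  filter_upwards [h] with y hy
  by_contra hyx
  exact hne x y (Ne.symm hyx) hx hy

/-- The law putting mass `t` at `x` and `1 - t` at `y`. -/
noncomputable def twoPoint (t : ℝ) (x y : E) : Measure E :=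
  ENNReal.ofReal t • Measure.dirac x + ENNReal.ofReal (1 - t) • Measure.dirac y

theorem isProbabilityMeasure_twoPoint {t : ℝ} (ht : t ∈ Set.Ioo (0 : ℝ) 1) (x y : E) :
    IsProbabilityMeasure (twoPoint t x y) := by
  refine ⟨?_⟩
  simp only [twoPoint, Measure.add_apply, Measure.smul_apply, measure_univ, smul_eq_mul, mul_one]
  rw [← ENNReal.ofReal_add ht.1.le (sub_nonneg.2 ht.2.le)]
  simp

theorem twoPoint_conv_twoPoint [AddMonoid E] [MeasurableAdd₂ E] (s t : ℝ) (x y z w : E) :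
    (twoPoint s x y).conv (twoPoint t z w) =
      (ENNReal.ofReal t * ENNReal.ofReal s) • Measure.dirac (x + z) +
      ((ENNReal.ofReal t * ENNReal.ofReal (1 - s)) • Measure.dirac (y + z) +
      ((ENNReal.ofReal (1 - t) * ENNReal.ofReal s) • Measure.dirac (x + w) +
      (ENNReal.ofReal (1 - t) * ENNReal.ofReal (1 - s)) • Measure.dirac (y + w))) := by
  simp only [twoPoint, Measure.add_conv, Measure.conv_add, Measure.conv_smul_left,
    Measure.conv_smul_right, Measure.dirac_conv_dirac, smul_add, smul_smul, add_assoc]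

variable [MeasurableSingletonClass E]

theorem not_isDegenerate_twoPoint {t : ℝ} (ht : t ∈ Set.Ioo (0 : ℝ) 1) {x y : E} (hxy : x ≠ y) :
    ¬ IsDegenerate (twoPoint t x y) := by
  classical
  rintro ⟨z, hz⟩
  have hx := congrArg (fun ν => ν {x}) hz
  simp only [twoPoint, Measure.add_apply, Measure.smul_apply, Measure.dirac_apply, smul_eq_mul,
    Set.indicator_apply, Set.mem_singleton_iff, hxy.symm, if_true, if_false, mul_zero, add_zero,
    Pi.one_apply, mul_one] at hx
  split_ifs at hx
  · exact ht.2.ne (by simpa using hx)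
  · exact ht.1.not_ge (by simpa using hx)

/-- A measure carried by a finite set is a combination of point masses. -/
theorem eq_sum_smul_dirac_of_ae_mem {μ : Measure E} {s : Finset E} (h : ∀ᵐ x ∂μ, x ∈ s) :
    μ = ∑ x ∈ s, μ {x} • Measure.dirac x := by
  classical
  have key : ∀ s : Finset E, μ.restrict s = ∑ x ∈ s, μ {x} • Measure.dirac x := by
    intro s
    induction s using Finset.induction_on with
    | empty => simp
    | insert a s ha ih =>
      rw [Finset.sum_insert ha, Finset.coe_insert, Set.insert_eq,
        Measure.restrict_union (by simpa using ha) s.measurableSet, ih,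
        Measure.restrict_singleton]
  rw [← key]
  exact (Measure.restrict_eq_self_of_ae_mem (by simpa using h)).symm

theorem exists_eq_twoPoint {μ : Measure E} [IsProbabilityMeasure μ] (hμ : ¬ IsDegenerate μ)
    {x y : E} (hxy : x ≠ y) (h : ∀ᵐ z ∂μ, z = x ∨ z = y) :
    ∃ t ∈ Set.Ioo (0 : ℝ) 1, μ = twoPoint t x y := by
  classical
  have hsum := eq_sum_smul_dirac_of_ae_mem (μ := μ) (s := {x, y}) (by simpa using h)
  rw [Finset.sum_pair hxy] at hsum
  have huniv := congrArg (fun ν => ν Set.univ) hsum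
  simp only [Measure.add_apply, Measure.smul_apply, measure_univ, smul_eq_mul, mul_one] at huniv
  have hreal : μ.real {x} + μ.real {y} = 1 := by
    rw [measureReal_def, measureReal_def, ← ENNReal.toReal_add (by simp) (by simp), ← huniv]
    simp
  have pos : ∀ a b : E, (∀ᵐ z ∂μ, z = a ∨ z = b) → 0 < μ.real {a} := by
    intro a b hab
    refine measureReal_nonneg.lt_of_ne fun h0 => hμ (isDegenerate_of_ae_eq (x := b) ?_)
    have ha : ∀ᵐ z ∂μ, z ≠ a := by
      rw [ae_iff]
      simpa using (measureReal_eq_zero_iff (by simp)).1 h0.symm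
    filter_upwards [hab, ha] with z hz hza
    exact hz.resolve_left hza
  refine ⟨μ.real {x}, ⟨pos x y h, ?_⟩, ?_⟩
  · linarith [pos y x (h.mono fun _ => Or.symm)]
  · rw [twoPoint, show 1 - μ.real {x} = μ.real {y} by linarith]
    simpa using hsum

theorem eq_sum_dirac_of_measure_singleton {μ : Measure E} [IsProbabilityMeasure μ] {p q r s : E}
    {w₁ w₂ w₃ w₄ : ℝ≥0∞} (hpq : p ≠ q) (hpr : p ≠ r) (hps : p ≠ s) (hqr : q ≠ r) (hqs : q ≠ s)
    (hrs : r ≠ s) (hp : μ {p} = w₁) (hq : μ {q} = w₂) (hr : μ {r} = w₃) (hs : μ {s} = w₄)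
    (hw : w₁ + (w₂ + (w₃ + w₄)) = 1) :
    μ = w₁ • Measure.dirac p + (w₂ • Measure.dirac q +
      (w₃ • Measure.dirac r + w₄ • Measure.dirac s)) := by
  classical
  have hp' : p ∉ ({q, r, s} : Finset E) := by simp [hpq, hpr, hps]
  have hq' : q ∉ ({r, s} : Finset E) := by simp [hqr, hqs]
  have hmem : ∀ᵐ x ∂μ, x ∈ ({p, q, r, s} : Finset E) := by
    have hone : μ (({p, q, r, s} : Finset E) : Set E) = 1 := by
      rw [← sum_measure_singleton, Finset.sum_insert hp', Finset.sum_insert hq',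
        Finset.sum_pair hrs, hp, hq, hr, hs, hw]
    exact (prob_compl_eq_zero_iff (Finset.measurableSet _)).2 hone
  rw [eq_sum_smul_dirac_of_ae_mem hmem, Finset.sum_insert hp', Finset.sum_insert hq',
    Finset.sum_pair hrs, hp, hq, hr, hs]

theorem sum_dirac_apply_singleton {p q r s : E} (w₁ w₂ w₃ w₄ : ℝ≥0∞)
    (hpq : p ≠ q) (hpr : p ≠ r) (hps : p ≠ s) (hqr : q ≠ r) (hqs : q ≠ s) (hrs : r ≠ s) :
    let μ := w₁ • Measure.dirac p + (w₂ • Measure.dirac q +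
      (w₃ • Measure.dirac r + w₄ • Measure.dirac s))
    μ {p} = w₁ ∧ μ {q} = w₂ ∧ μ {r} = w₃ ∧ μ {s} = w₄ := by
  simp [hpq, hpr, hps, hqr, hqs, hrs, hpq.symm, hpr.symm, hps.symm,
    hqr.symm, hqs.symm, hrs.symm]

end TwoPointMeasures

section Hyperbola

/-- Points of the curve `z₁ z₂ = c` whose translates by `v` stay on it are equal or symmetric. -/
theorem eq_or_add_eq_neg_of_mul_eq {c : ℝ} {v z w : ℝ × ℝ} (hv₁ : v.1 ≠ 0) (hv₂ : v.2 ≠ 0)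
    (hz : z.1 * z.2 = c) (hzv : (z + v).1 * (z + v).2 = c)
    (hw : w.1 * w.2 = c) (hwv : (w + v).1 * (w + v).2 = c) :
    z = w ∨ z + w = -v := by
  obtain ⟨z₁, z₂⟩ := z
  obtain ⟨w₁, w₂⟩ := w
  obtain ⟨v₁, v₂⟩ := v
  simp only [Prod.mk_add_mk, Prod.mk.injEq, Prod.neg_mk] at *
  have lz : z₁ * v₂ + z₂ * v₁ + v₁ * v₂ = 0 := by linear_combination hzv - hz
  have lw : w₁ * v₂ + w₂ * v₁ + v₁ * v₂ = 0 := by linear_combination hwv - hw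
  have hprod : (z₁ - w₁) * (z₁ + w₁ + v₁) = 0 := by
    have : v₂ * ((z₁ - w₁) * (z₁ + w₁ + v₁)) = 0 := by
      linear_combination z₁ * lz - w₁ * lw - v₁ * hz + v₁ * hw
    exact (mul_eq_zero.1 this).resolve_left hv₂
  rcases mul_eq_zero.1 hprod with h | h
  · left
    refine ⟨by linarith, mul_left_cancel₀ hv₁ ?_⟩
    linear_combination lz - lw - v₂ * h
  · right
    refine ⟨by linarith, mul_left_cancel₀ hv₁ ?_⟩
    linear_combination lz + lw - v₂ * h

theorem eq_or_eq_of_add_mul_eq {c : ℝ} {a a' b b' y : ℝ × ℝ}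
    (ha₁ : (a' - a).1 ≠ 0) (ha₂ : (a' - a).2 ≠ 0) (hb : b ≠ b')
    (h₁ : (a + b).1 * (a + b).2 = c) (h₂ : (a' + b).1 * (a' + b).2 = c)
    (h₃ : (a + b').1 * (a + b').2 = c) (h₄ : (a' + b').1 * (a' + b').2 = c)
    (h₅ : (a + y).1 * (a + y).2 = c) (h₆ : (a' + y).1 * (a' + y).2 = c) :
    y = b' ∨ y = b := by
  have shift : ∀ z, a' + z = (a + z) + (a' - a) := fun z => by abel
  rw [shift] at h₂ h₄ h₆
  rcases eq_or_add_eq_neg_of_mul_eq ha₁ ha₂ h₁ h₂ h₅ h₆ with h | h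
  · exact Or.inr (add_left_cancel h).symm
  · rcases eq_or_add_eq_neg_of_mul_eq ha₁ ha₂ h₁ h₂ h₃ h₄ with h' | h'
    · exact absurd (add_left_cancel h') hb
    · exact Or.inl (add_left_cancel (add_left_cancel (h.trans h'.symm)))

/-- If all sums of `a, a'` with `b, b'` lie on `z₁ z₂ = c`, the parallelogram they span is
determined by its sides. -/
theorem parallelogram_of_mul_eq {c : ℝ} {a a' b b' : ℝ × ℝ}
    (ha₁ : (a' - a).1 ≠ 0) (ha₂ : (a' - a).2 ≠ 0) (hb : b.1 < b'.1)
    (h₁ : (a + b).1 * (a + b).2 = c) (h₂ : (a' + b).1 * (a' + b).2 = c)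
    (h₃ : (a + b').1 * (a + b').2 = c) (h₄ : (a' + b').1 * (a' + b').2 = c) :
    let v := a' - a
    let D := v.1 ^ 2 - 4 * c * v.1 * v.2⁻¹
    let a₁ := (v.1 + √D) / 2
    let a₂ := (v.1 - √D) / 2
    0 < D ∧ a' + b' = (a₁, a₂ * v.1⁻¹ * v.2) ∧ a' + b = (a₂, a₁ * v.1⁻¹ * v.2) ∧
      a + b' = (-a₂, -(a₁ * v.1⁻¹ * v.2)) ∧ a + b = (-a₁, -(a₂ * v.1⁻¹ * v.2)) := by
  have shift : ∀ z, a' + z = (a + z) + (a' - a) := fun z => by abel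
  have hsum : (a + b) + (a + b') = -(a' - a) := by
    rw [shift] at h₂ h₄
    refine (eq_or_add_eq_neg_of_mul_eq ha₁ ha₂ h₁ h₂ h₃ h₄).resolve_left fun h => ?_
    exact hb.ne (congrArg Prod.fst (add_left_cancel h))
  obtain ⟨x₁, x₂⟩ := a
  obtain ⟨x₁', x₂'⟩ := a'
  obtain ⟨y₁, y₂⟩ := b
  obtain ⟨y₁', y₂'⟩ := b'
  simp only [Prod.mk_add_mk, Prod.mk_sub_mk, Prod.mk.injEq, Prod.neg_mk] at *
  obtain ⟨s₁, s₂⟩ := hsum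
  have cross : (y₁' - y₁) * (x₂' - x₂) + (y₂' - y₂) * (x₁' - x₁) = 0 := by
    linear_combination h₄ - h₃ - h₂ + h₁
  have hD : (x₁' - x₁) ^ 2 - 4 * c * (x₁' - x₁) * (x₂' - x₂)⁻¹ = (y₁' - y₁) ^ 2 := by
    have h4c : 4 * c = ((y₁' - y₁) + (x₁' - x₁)) * ((y₂' - y₂) + (x₂' - x₂)) := by
      linear_combination -4 * h₁ + 2 * (x₂ + y₂) * s₁ - ((y₁' - y₁) + (x₁' - x₁)) * s₂
    field_simp
    linear_combination -(x₁' - x₁) * h4c - ((y₁' - y₁) + (x₁' - x₁)) * cross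
  have hslope₁ : (y₁' - y₁) * (x₁' - x₁)⁻¹ * (x₂' - x₂) = -(y₂' - y₂) := by
    field_simp
    linear_combination cross
  have hslope₂ : (x₁' - x₁) * (x₁' - x₁)⁻¹ * (x₂' - x₂) = x₂' - x₂ := by
    field_simp
  have hpos : 0 < y₁' - y₁ := sub_pos.2 hb
  rw [hD, Real.sqrt_sq hpos.le]
  refine ⟨by positivity, ⟨?_, ?_⟩, ⟨?_, ?_⟩, ⟨?_, ?_⟩, ?_, ?_⟩ <;> grind

end Hyperbola

section Decomposition

theorem ae_conv_iff_ae_ae {μ₁ μ₂ : Measure (ℝ × ℝ)} [IsProbabilityMeasure μ₁]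
    [IsProbabilityMeasure μ₂] {p : ℝ × ℝ → Prop} (hp : MeasurableSet {z | p z}) :
    (∀ᵐ z ∂μ₁.conv μ₂, p z) ↔ ∀ᵐ x ∂μ₁, ∀ᵐ y ∂μ₂, p (x + y) := by
  rw [Measure.conv, ae_map_iff (by fun_prop) hp]
  exact Measure.ae_prod_iff_ae_ae (measurable_add hp)

/-- If `f` is almost surely constant under both factors, it is so under the convolution. -/
theorem ae_conv_eq_zero {μ₁ μ₂ : Measure (ℝ × ℝ)} [IsProbabilityMeasure μ₁]
    [IsProbabilityMeasure μ₂] {f : ℝ × ℝ →+ ℝ} (hf : Measurable f) {a b : ℝ × ℝ}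
    (h₁ : ∀ᵐ x ∂μ₁, f (x + b) = 0) (h₂ : ∀ᵐ y ∂μ₂, f (a + y) = 0) (hab : f (a + b) = 0) :
    ∀ᵐ z ∂μ₁.conv μ₂, f z = 0 := by
  refine (ae_conv_iff_ae_ae (hf (measurableSet_singleton 0))).2 ?_
  filter_upwards [h₁] with x hx
  filter_upwards [h₂] with y hy
  rw [map_add] at hx hy hab
  change f (x + y) = 0
  rw [map_add]
  linarith

/-- A decomposition of a law on `z₁ z₂ = c` with nondegenerate coordinates has two-point factors
spanning a parallelogram inscribed in that curve. -/
theorem exists_twoPoint_of_conv {μ₁ μ₂ : Measure (ℝ × ℝ)} [IsProbabilityMeasure μ₁]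
    [IsProbabilityMeasure μ₂] (hμ₁ : ¬ IsDegenerate μ₁) (hμ₂ : ¬ IsDegenerate μ₂) {c : ℝ}
    (hc : ∀ᵐ z ∂μ₁.conv μ₂, z.1 * z.2 = c)
    (hfst : ∀ d, ¬ ∀ᵐ z ∂μ₁.conv μ₂, z.1 = d) (hsnd : ∀ d, ¬ ∀ᵐ z ∂μ₁.conv μ₂, z.2 = d) :
    ∃ (a a' b b' : ℝ × ℝ) (α β : ℝ), (a' - a).1 ≠ 0 ∧ (a' - a).2 ≠ 0 ∧ b.1 < b'.1 ∧
      (a + b).1 * (a + b).2 = c ∧ (a' + b).1 * (a' + b).2 = c ∧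
      (a + b').1 * (a + b').2 = c ∧ (a' + b').1 * (a' + b').2 = c ∧
      α ∈ Set.Ioo (0 : ℝ) 1 ∧ β ∈ Set.Ioo (0 : ℝ) 1 ∧
      μ₁ = twoPoint β a' a ∧ μ₂ = twoPoint α b' b := by
  have hS : MeasurableSet {z : ℝ × ℝ | z.1 * z.2 = c} :=
    (measurable_fst.mul measurable_snd) (measurableSet_singleton c)
  have hx := (ae_conv_iff_ae_ae hS).1 hc
  have hy := (Measure.ae_ae_comm
    (p := fun x y : ℝ × ℝ => (x + y).1 * (x + y).2 = c) (measurable_add hS)).1 hx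
  obtain ⟨a, a', haa', ha, ha'⟩ := exists_ne_of_ae hμ₁ hx
  obtain ⟨b, b', hbb', hb, hb'⟩ := exists_ne_of_ae hμ₂ ((ha.and ha').and hy)
  obtain ⟨⟨hab, ha'b⟩, hb⟩ := hb
  obtain ⟨⟨hab', ha'b'⟩, hb'⟩ := hb'
  have hcross : (b' - b).1 * (a' - a).2 + (b' - b).2 * (a' - a).1 = 0 := by
    simp only [Prod.fst_add, Prod.snd_add, Prod.fst_sub, Prod.snd_sub] at *
    linear_combination ha'b' - hab' - ha'b + hab
  have hane : ¬ ((a' - a).1 = 0 ∧ (a' - a).2 = 0) := fun h =>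
    haa' (sub_eq_zero.1 (Prod.ext h.1 h.2)).symm
  have hbne : ¬ ((b' - b).1 = 0 ∧ (b' - b).2 = 0) := fun h =>
    hbb' (sub_eq_zero.1 (Prod.ext h.1 h.2)).symm
  have ha₁ : (a' - a).1 ≠ 0 := by
    intro h0
    have h0' : (b' - b).1 = 0 := by grind
    have key : ∀ z v : ℝ × ℝ, v.1 = 0 → ¬ (v.1 = 0 ∧ v.2 = 0) → z.1 * z.2 = c →
        (z + v).1 * (z + v).2 = c → z.1 = 0 := by
      intro z v hv hv' hz hzv
      simp only [Prod.fst_add, Prod.snd_add] at hzv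
      grind
    refine hfst 0 (ae_conv_eq_zero (f := AddMonoidHom.fst ℝ ℝ) measurable_fst
      (a := a) (b := b) ?_ ?_ ?_)
    · filter_upwards [hb, hb'] with x hxb hxb'
      exact key _ _ h0' hbne hxb (by rwa [add_assoc, add_sub_cancel])
    · filter_upwards [ha, ha'] with y hay ha'y
      exact key _ _ h0 hane hay (by rwa [add_right_comm, add_sub_cancel])
    · exact key _ _ h0 hane hab (by rwa [add_right_comm, add_sub_cancel])
  have ha₂ : (a' - a).2 ≠ 0 := by
    intro h0
    have h0' : (b' - b).2 = 0 := by grind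
    have key : ∀ z v : ℝ × ℝ, v.2 = 0 → ¬ (v.1 = 0 ∧ v.2 = 0) → z.1 * z.2 = c →
        (z + v).1 * (z + v).2 = c → z.2 = 0 := by
      intro z v hv hv' hz hzv
      simp only [Prod.fst_add, Prod.snd_add] at hzv
      grind
    refine hsnd 0 (ae_conv_eq_zero (f := AddMonoidHom.snd ℝ ℝ) measurable_snd
      (a := a) (b := b) ?_ ?_ ?_)
    · filter_upwards [hb, hb'] with x hxb hxb'
      exact key _ _ h0' hbne hxb (by rwa [add_assoc, add_sub_cancel])
    · filter_upwards [ha, ha'] with y hay ha'y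
      exact key _ _ h0 hane hay (by rwa [add_right_comm, add_sub_cancel])
    · exact key _ _ h0 hane hab (by rwa [add_right_comm, add_sub_cancel])
  have hb₁ : (b' - b).1 ≠ 0 := by grind
  have hb₂ : (b' - b).2 ≠ 0 := by grind
  have hμ₂b : ∀ᵐ y ∂μ₂, y = b' ∨ y = b := by
    filter_upwards [ha, ha'] with y hay ha'y
    exact eq_or_eq_of_add_mul_eq ha₁ ha₂ hbb' hab ha'b hab' ha'b' hay ha'y
  have hμ₁a : ∀ᵐ x ∂μ₁, x = a' ∨ x = a := by
    filter_upwards [hb, hb'] with x hxb hxb'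
    rw [add_comm] at hxb hxb'
    rw [add_comm] at hab ha'b hab' ha'b'
    exact eq_or_eq_of_add_mul_eq hb₁ hb₂ haa' hab hab' ha'b ha'b' hxb hxb'
  obtain ⟨β, hβ, hμ₁β⟩ := exists_eq_twoPoint hμ₁ haa'.symm hμ₁a
  rcases lt_or_gt_of_ne (show b.1 ≠ b'.1 from fun h => hb₁ (by simp [h])) with hlt | hlt
  · obtain ⟨α, hα, hμ₂α⟩ := exists_eq_twoPoint hμ₂ hbb'.symm hμ₂b
    exact ⟨a, a', b, b', α, β, ha₁, ha₂, hlt, hab, ha'b, hab', ha'b', hα, hβ, hμ₁β, hμ₂α⟩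
  · obtain ⟨α, hα, hμ₂α⟩ := exists_eq_twoPoint hμ₂ hbb' (hμ₂b.mono fun _ => Or.symm)
    exact ⟨a, a', b', b, α, β, ha₁, ha₂, hlt, hab', ha'b', hab, ha'b, hα, hβ, hμ₁β, hμ₂α⟩

end Decomposition

/-- **Remark 3(iii).** Let `U, W` be nondegenerate random variables with `P(UW = c) = 1`
for a constant `c ∈ ℝ`.  Then the distribution of `(U, W)` is decomposable if and only if,
for some `b₁, b₂ ≠ 0` with `b₁² − 4cb₁b₂⁻¹ > 0` and some `α, β ∈ (0,1)`, with
`a₁ = (b₁ + √(b₁² − 4cb₁b₂⁻¹))/2` and `a₂ = (b₁ − √(b₁² − 4cb₁b₂⁻¹))/2`, the law of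
`(U,W)` puts mass `αβ` at `(a₁, a₂b₁⁻¹b₂)`, `(1−α)β` at `(a₂, a₁b₁⁻¹b₂)`, `α(1−β)` at
`(−a₂, −a₁b₁⁻¹b₂)`, and `(1−α)(1−β)` at `(−a₁, −a₂b₁⁻¹b₂)`. -/
theorem decomposable_iff_four_point_law
    {Ω : Type*} [MeasurableSpace Ω] (P : Measure Ω) [IsProbabilityMeasure P]
    (U W : Ω → ℝ) (hU : Measurable U) (hW : Measurable W)
    (hUnd : ¬ IsDegenerate (P.map U)) (hWnd : ¬ IsDegenerate (P.map W))
    (c : ℝ) (hprod : P {ω | U ω * W ω = c} = 1) :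
    Decomposable (P.map fun ω => (U ω, W ω)) ↔
      ∃ b₁ b₂ α β : ℝ, b₁ ≠ 0 ∧ b₂ ≠ 0 ∧ 0 < b₁ ^ 2 - 4 * c * b₁ * b₂⁻¹ ∧
        α ∈ Set.Ioo (0:ℝ) 1 ∧ β ∈ Set.Ioo (0:ℝ) 1 ∧
        (let a₁ := (b₁ + Real.sqrt (b₁ ^ 2 - 4 * c * b₁ * b₂⁻¹)) / 2
         let a₂ := (b₁ - Real.sqrt (b₁ ^ 2 - 4 * c * b₁ * b₂⁻¹)) / 2
         (P.map fun ω => (U ω, W ω)) {(a₁, a₂ * b₁⁻¹ * b₂)} = ENNReal.ofReal (α * β) ∧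
         (P.map fun ω => (U ω, W ω)) {(a₂, a₁ * b₁⁻¹ * b₂)} = ENNReal.ofReal ((1 - α) * β) ∧
         (P.map fun ω => (U ω, W ω)) {(-a₂, -(a₁ * b₁⁻¹ * b₂))} = ENNReal.ofReal (α * (1 - β)) ∧
         (P.map fun ω => (U ω, W ω)) {(-a₁, -(a₂ * b₁⁻¹ * b₂))} = ENNReal.ofReal ((1 - α) * (1 - β))) := by
  have hpair : Measurable fun ω => (U ω, W ω) := hU.prodMk hW
  have := Measure.isProbabilityMeasure_map (μ := P) hpair.aemeasurable
  constructor
  · rintro ⟨μ₁, μ₂, hprob₁, hprob₂, hμ₁, hμ₂, hconv⟩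
    have hS : MeasurableSet {z : ℝ × ℝ | z.1 * z.2 = c} :=
      (measurable_fst.mul measurable_snd) (measurableSet_singleton c)
    have hae : ∀ᵐ ω ∂P, U ω * W ω = c :=
      (prob_compl_eq_zero_iff (hpair hS)).2 hprod
    obtain ⟨a, a', b, b', α, β, ha₁, ha₂, hlt, h₁, h₂, h₃, h₄, hα, hβ, rfl, rfl⟩ :=
      exists_twoPoint_of_conv (c := c) hμ₁ hμ₂
        (by rw [← hconv]; exact (ae_map_iff hpair.aemeasurable hS).2 hae)
        (fun d hd => hUnd <| isDegenerate_map_of_ae_eq (x := d) <| by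
          rw [← hconv] at hd; exact ae_of_ae_map hpair.aemeasurable hd)
        (fun d hd => hWnd <| isDegenerate_map_of_ae_eq (x := d) <| by
          rw [← hconv] at hd; exact ae_of_ae_map hpair.aemeasurable hd)
    obtain ⟨hD, e₁, e₂, e₃, e₄⟩ := parallelogram_of_mul_eq ha₁ ha₂ hlt h₁ h₂ h₃ h₄
    refine ⟨(a' - a).1, (a' - a).2, α, β, ha₁, ha₂, hD, hα, hβ, ?_⟩
    have haa' : a' ≠ a := fun h => ha₁ (by simp [h])
    have hbb' : b' ≠ b := fun h => hlt.ne (by simp [h])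
    have hdiag : a' + b' ≠ a + b ∧ a + b' ≠ a' + b := by
      simp only [Ne, Prod.ext_iff, Prod.fst_add, Prod.snd_add, Prod.fst_sub, Prod.snd_sub] at *
      grind
    intro a₁ a₂
    rw [← e₁, ← e₂, ← e₃, ← e₄, hconv, twoPoint_conv_twoPoint,
      ENNReal.ofReal_mul hα.1.le, ENNReal.ofReal_mul hα.1.le,
      ENNReal.ofReal_mul (sub_nonneg.2 hα.2.le), ENNReal.ofReal_mul (sub_nonneg.2 hα.2.le)]
    obtain ⟨m₁, m₂, m₃, m₄⟩ := sum_dirac_apply_singleton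
      (ENNReal.ofReal α * ENNReal.ofReal β) (ENNReal.ofReal α * ENNReal.ofReal (1 - β))
      (ENNReal.ofReal (1 - α) * ENNReal.ofReal β)
      (ENNReal.ofReal (1 - α) * ENNReal.ofReal (1 - β))
      (p := a' + b') (q := a + b') (r := a' + b) (s := a + b)
      (by simpa using haa') (by simpa using hbb') hdiag.1 hdiag.2 (by simpa using hbb')
      (by simpa using haa')
    exact ⟨m₁, m₃, m₂, m₄⟩
  · rintro ⟨b₁, b₂, α, β, hb₁, hb₂, hD, hα, hβ, h₁, h₂, h₃, h₄⟩
    have hs : 0 < √(b₁ ^ 2 - 4 * c * b₁ * b₂⁻¹) := Real.sqrt_pos.2 hD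
    set s := √(b₁ ^ 2 - 4 * c * b₁ * b₂⁻¹)
    set r := b₁⁻¹ * b₂ with hr
    have hr0 : r ≠ 0 := mul_ne_zero (inv_ne_zero hb₁) hb₂
    have hb₂r : b₂ = b₁ * r := by rw [hr]; field_simp
    simp only [mul_assoc, ← hr] at h₁ h₂ h₃ h₄
    have hα₀ := hα.1
    have hβ₀ := hβ.1
    have hα' := sub_nonneg.2 hα.2.le
    have hβ' := sub_nonneg.2 hβ.2.le
    have hlaw := eq_sum_dirac_of_measure_singleton
      (by simp only [Ne, Prod.mk.injEq]; grind) (by simp only [Ne, Prod.mk.injEq]; grind)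
      (by simp only [Ne, Prod.mk.injEq]; grind) (by simp only [Ne, Prod.mk.injEq]; grind)
      (by simp only [Ne, Prod.mk.injEq]; grind) (by simp only [Ne, Prod.mk.injEq]; grind)
      h₁ h₃ h₂ h₄
      (by
        rw [← ENNReal.ofReal_add (by positivity) (by positivity),
          ← ENNReal.ofReal_add (by positivity) (by positivity),
          ← ENNReal.ofReal_add (by positivity) (by positivity), ← ENNReal.ofReal_one]
        ring_nf)
    refine ⟨twoPoint β (b₁, b₂) 0, twoPoint α (-((b₁ - s) / 2), -((b₁ + s) / 2 * r))
      (-((b₁ + s) / 2), -((b₁ - s) / 2 * r)), isProbabilityMeasure_twoPoint hβ _ _,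
      isProbabilityMeasure_twoPoint hα _ _,
      not_isDegenerate_twoPoint hβ fun h => hb₁ (congrArg Prod.fst h),
      not_isDegenerate_twoPoint hα fun h => ?_, ?_⟩
    · have := congrArg Prod.fst h
      simp only at this
      linarith
    · rw [hlaw, twoPoint_conv_twoPoint, ENNReal.ofReal_mul hα.1.le, ENNReal.ofReal_mul hα.1.le,
        ENNReal.ofReal_mul hα', ENNReal.ofReal_mul hα']
      simp only [zero_add, Prod.mk_add_mk]
      rw [show b₁ + -((b₁ - s) / 2) = (b₁ + s) / 2 by ring,
        show b₁ + -((b₁ + s) / 2) = (b₁ - s) / 2 by ring,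
        show b₂ + -((b₁ + s) / 2 * r) = (b₁ - s) / 2 * r by rw [hb₂r]; ring,
        show b₂ + -((b₁ - s) / 2 * r) = (b₁ + s) / 2 * r by rw [hb₂r]; ring]
end

section
/- (Example 5 / Remark 5) Let C be a standard Cauchy random variable and let V be a positive random variable such that V² is distributed as |C|. Let λ ∈ (0,∞) and let (X₁,X₂) be a random vector on ℝ² whose characteristic function φ satisfies φ(t) = exp(−λ + λ ψ(t)) for all t ∈ ℝ², where ψ is the characteristic function of the random vector (V, V⁻¹). Then (X₁,X₂) is infinitely divisible, E(|X₁ X₂|) < ∞, E(|X₁|) < ∞, and E(|X₂|) < ∞, while E(X₁²) = E(X₂²) = ∞. -/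
open MeasureTheory ProbabilityTheory

/-- A probability distribution `μ` is infinitely divisible if for every `n ≥ 1` it is the
law of the sum of `n` i.i.d. copies of some probability distribution. -/
def IsInfinitelyDivisible {E : Type*} [MeasurableSpace E] [AddCommMonoid E]
    (μ : Measure E) : Prop :=
  ∀ n : ℕ, 0 < n → ∃ ρ : Measure E, IsProbabilityMeasure ρ ∧
    μ = Measure.map (fun x : Fin n → E => ∑ i, x i) (Measure.pi fun _ => ρ)

open scoped NNReal ENNReal

/-- The `n`-fold convolution of a measure with itself. -/
noncomputable def convPow {E : Type*} [MeasurableSpace E] [AddCommMonoid E]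
    (ν : Measure E) : ℕ → Measure E
  | 0 => Measure.dirac 0
  | n + 1 => ν.conv (convPow ν n)

/-- The law of the sum of a Poisson number, with rate `r`, of independent variables of law `ν`. -/
noncomputable def compoundPoisson {E : Type*} [MeasurableSpace E] [AddCommMonoid E]
    (r : ℝ≥0) (ν : Measure E) : Measure E :=
  Measure.sum fun n => ENNReal.ofReal (Real.exp (-r) * r ^ n / n.factorial) • convPow ν n

section CompoundPoisson

variable {E : Type*} [MeasurableSpace E]

instance isProbabilityMeasure_convPow [AddCommMonoid E] [MeasurableAdd₂ E] (ν : Measure E)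
    [IsProbabilityMeasure ν] (n : ℕ) : IsProbabilityMeasure (convPow ν n) := by
  induction n with
  | zero => exact Measure.dirac.isProbabilityMeasure
  | succ n ih =>
    rw [convPow]
    infer_instance

instance isProbabilityMeasure_compoundPoisson [AddCommMonoid E] [MeasurableAdd₂ E] (r : ℝ≥0)
    (ν : Measure E) [IsProbabilityMeasure ν] : IsProbabilityMeasure (compoundPoisson r ν) := by
  constructor
  have h := hasSum_one_poissonMeasure r
  rw [compoundPoisson, Measure.sum_apply _ MeasurableSet.univ]
  simp only [Measure.smul_apply, measure_univ, smul_eq_mul, mul_one]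
  rw [← ENNReal.ofReal_tsum_of_nonneg (fun n => by positivity) h.summable, h.tsum_eq,
    ENNReal.ofReal_one]

lemma lintegral_compoundPoisson [AddCommMonoid E] (r : ℝ≥0) (ν : Measure E) (f : E → ℝ≥0∞) :
    ∫⁻ x, f x ∂compoundPoisson r ν =
      ∑' n : ℕ, ENNReal.ofReal (Real.exp (-r) * r ^ n / n.factorial) *
        ∫⁻ x, f x ∂convPow ν n := by
  rw [compoundPoisson, lintegral_sum_measure]
  simp [lintegral_smul_measure]

variable {F : Type*} [NormedAddCommGroup F] [NormedSpace ℝ F] [MeasurableSpace F] [BorelSpace F]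
  [SecondCountableTopology F]

lemma charFunDual_convPow (ν : Measure F) [IsProbabilityMeasure ν] (L : StrongDual ℝ F) (n : ℕ) :
    charFunDual (convPow ν n) L = charFunDual ν L ^ n := by
  induction n with
  | zero => simp [convPow]
  | succ n ih => rw [convPow, charFunDual_conv, ih, pow_succ']

lemma charFunDual_compoundPoisson (r : ℝ≥0) (ν : Measure F) [IsProbabilityMeasure ν]
    (L : StrongDual ℝ F) :
    charFunDual (compoundPoisson r ν) L = Complex.exp (-(r : ℂ) + r * charFunDual ν L) := by
  have hint : Integrable (fun v => Complex.exp (L v * Complex.I)) (compoundPoisson r ν) :=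
    (integrable_const (1 : ℝ)).mono (by fun_prop) (by simp)
  have hterm (n : ℕ) : ∫ v, Complex.exp (L v * Complex.I)
      ∂(ENNReal.ofReal (Real.exp (-r) * r ^ n / n.factorial) • convPow ν n) =
        Complex.exp (-(r : ℂ)) * ((r * charFunDual ν L) ^ n / n.factorial) := by
    rw [integral_smul_measure, ENNReal.toReal_ofReal (by positivity), ← charFunDual_apply,
      charFunDual_convPow, Complex.real_smul]
    push_cast
    ring
  rw [charFunDual_apply, compoundPoisson, integral_sum_measure (by exact hint)]
  simp_rw [hterm]
  rw [tsum_mul_left, Complex.exp_add, Complex.exp_eq_exp_ℂ, NormedSpace.exp_eq_tsum_div]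

lemma isInfinitelyDivisible_compoundPoisson [CompleteSpace F] (r : ℝ≥0) (ν : Measure F)
    [IsProbabilityMeasure ν] : IsInfinitelyDivisible (compoundPoisson r ν) := by
  intro n hn
  refine ⟨compoundPoisson (r / n) ν, inferInstance, ?_⟩
  have : IsProbabilityMeasure (Measure.map (fun x : Fin n → F => ∑ i, x i)
      (Measure.pi fun _ => compoundPoisson (r / n) ν)) :=
    Measure.isProbabilityMeasure_map (by fun_prop)
  refine Measure.ext_of_charFunDual (funext fun L => ?_)
  rw [charFunDual_map_sum_pi_eq_prod]
  have hn' : (n : ℂ) ≠ 0 := by exact_mod_cast hn.ne'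
  simp only [Finset.prod_apply, charFunDual_compoundPoisson, Finset.prod_const, Finset.card_univ,
    Fintype.card_fin, ← Complex.exp_nat_mul]
  congr 1
  push_cast
  field_simp

end CompoundPoisson

section Moments

variable {E : Type*} [MeasurableSpace E] [AddCommMonoid E] {f g : E → ℝ≥0∞}

lemma lintegral_convPow_le [MeasurableAdd₂ E] (ν : Measure E)
    [IsProbabilityMeasure ν] (hf : Measurable f)
    (hf_zero : f 0 = 0) (hf_add : ∀ x y, f (x + y) ≤ f x + f y) (n : ℕ) :
    ∫⁻ x, f x ∂convPow ν n ≤ n * ∫⁻ x, f x ∂ν := by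
  induction n with
  | zero => simp [convPow, lintegral_dirac' _ hf, hf_zero]
  | succ n ih =>
    rw [convPow, Measure.lintegral_conv hf]
    calc ∫⁻ x, ∫⁻ y, f (x + y) ∂convPow ν n ∂ν
        ≤ ∫⁻ x, ∫⁻ y, f x + f y ∂convPow ν n ∂ν := by gcongr; exact hf_add _ _
      _ = ∫⁻ x, f x ∂ν + ∫⁻ y, f y ∂convPow ν n := by
          simp [lintegral_add_left, hf]
      _ ≤ ∫⁻ x, f x ∂ν + n * ∫⁻ x, f x ∂ν := by gcongr
      _ = _ := by push_cast; ring

lemma lintegral_mul_convPow_le [MeasurableAdd₂ E] (ν : Measure E)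
    [IsProbabilityMeasure ν] (hf : Measurable f)
    (hg : Measurable g) (hf_zero : f 0 = 0) (hg_zero : g 0 = 0)
    (hf_add : ∀ x y, f (x + y) ≤ f x + f y) (hg_add : ∀ x y, g (x + y) ≤ g x + g y)
    {M : ℝ≥0∞} (hfg : ∫⁻ x, f x * g x ∂ν ≤ M) (hM : (∫⁻ x, f x ∂ν) * ∫⁻ x, g x ∂ν ≤ M) (n : ℕ) :
    ∫⁻ x, f x * g x ∂convPow ν n ≤ n ^ 2 * M := by
  induction n with
  | zero => rw [convPow, lintegral_dirac' _ (by fun_prop)]; simp [hf_zero]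
  | succ n ih =>
    have hfn := lintegral_convPow_le ν hf hf_zero hf_add n
    have hgn := lintegral_convPow_le ν hg hg_zero hg_add n
    rw [convPow, Measure.lintegral_conv (by fun_prop)]
    calc ∫⁻ x, ∫⁻ y, f (x + y) * g (x + y) ∂convPow ν n ∂ν
        ≤ ∫⁻ x, ∫⁻ y, f x * g x + f x * g y + g x * f y + f y * g y ∂convPow ν n ∂ν := by
          gcongr with x y
          calc f (x + y) * g (x + y) ≤ (f x + f y) * (g x + g y) := by
                gcongr
                exacts [hf_add _ _, hg_add _ _]
            _ = _ := by ring
      _ = ∫⁻ x, f x * g x ∂ν + (∫⁻ x, f x ∂ν) * ∫⁻ y, g y ∂convPow ν n +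
            (∫⁻ x, g x ∂ν) * ∫⁻ y, f y ∂convPow ν n + ∫⁻ y, f y * g y ∂convPow ν n := by
          have hinner (x : E) :
              ∫⁻ y, f x * g x + f x * g y + g x * f y + f y * g y ∂convPow ν n =
                f x * g x + f x * ∫⁻ y, g y ∂convPow ν n + g x * ∫⁻ y, f y ∂convPow ν n +
                  ∫⁻ y, f y * g y ∂convPow ν n := by
            rw [lintegral_add_left (by fun_prop), lintegral_add_left (by fun_prop),
              lintegral_add_left (by fun_prop), lintegral_const_mul _ hg,
              lintegral_const_mul _ hf, lintegral_const, measure_univ, mul_one]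
          simp_rw [hinner]
          rw [lintegral_add_left (by fun_prop), lintegral_add_left (by fun_prop),
              lintegral_add_left (by fun_prop), lintegral_mul_const _ hg,
              lintegral_mul_const _ hf, lintegral_const, measure_univ, mul_one]
      _ ≤ M + (∫⁻ x, f x ∂ν) * (n * ∫⁻ x, g x ∂ν) +
            (∫⁻ x, g x ∂ν) * (n * ∫⁻ x, f x ∂ν) + n ^ 2 * M := by gcongr
      _ = M + 2 * n * ((∫⁻ x, f x ∂ν) * ∫⁻ x, g x ∂ν) + n ^ 2 * M := by ring
      _ ≤ M + 2 * n * M + n ^ 2 * M := by gcongr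
      _ = _ := by push_cast; ring

lemma tsum_poisson_mul_sq_ne_top (r : ℝ≥0) :
    ∑' n : ℕ, ENNReal.ofReal (Real.exp (-r) * r ^ n / n.factorial) * (n : ℝ≥0∞) ^ 2 ≠ ∞ := by
  have hsum : Summable fun n : ℕ => Real.exp (-r) * r ^ n / n.factorial * (n : ℝ) ^ 2 := by
    have h := (Real.summable_pow_div_factorial (4 * (r : ℝ))).mul_left (Real.exp (-r))
    refine h.of_nonneg_of_le (fun n => by positivity) fun n => ?_
    have hn : (n : ℝ) ≤ 2 ^ n := by exact_mod_cast Nat.lt_two_pow_self.le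
    calc Real.exp (-r) * r ^ n / n.factorial * (n : ℝ) ^ 2
        ≤ Real.exp (-r) * r ^ n / n.factorial * (2 ^ n) ^ 2 := by gcongr
      _ = Real.exp (-r) * ((4 * r) ^ n / n.factorial) := by
          rw [mul_pow, ← pow_mul, mul_comm n 2, pow_mul]
          norm_num
          ring
  convert hsum.tsum_ofReal_ne_top using 4 with n
  rw [ENNReal.ofReal_mul (by positivity), ENNReal.ofReal_pow (by positivity),
    ENNReal.ofReal_natCast]

lemma lintegral_compoundPoisson_ne_top {r : ℝ≥0} {ν : Measure E} {M : ℝ≥0∞} (hM : M ≠ ∞)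
    (h : ∀ n : ℕ, ∫⁻ x, f x ∂convPow ν n ≤ n ^ 2 * M) :
    ∫⁻ x, f x ∂compoundPoisson r ν ≠ ∞ := by
  rw [lintegral_compoundPoisson]
  refine ne_top_of_le_ne_top (ENNReal.mul_ne_top (tsum_poisson_mul_sq_ne_top r) hM) ?_
  rw [← ENNReal.tsum_mul_right]
  refine ENNReal.tsum_le_tsum fun n => ?_
  rw [mul_assoc]
  gcongr
  exact h n

lemma lintegral_compoundPoisson_eq_top [MeasurableAdd₂ E] {r : ℝ≥0} (hr : 0 < r) {ν : Measure E}
    [IsProbabilityMeasure ν] (h : ∫⁻ x, f x ∂ν = ∞) :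
    ∫⁻ x, f x ∂compoundPoisson r ν = ∞ := by
  have hone : convPow ν 1 = ν := by simp [convPow]
  rw [lintegral_compoundPoisson, eq_top_iff]
  refine le_trans ?_ (ENNReal.le_tsum 1)
  rw [hone, h, ENNReal.mul_top]
  have : 0 < (r : ℝ) := hr
  simp only [ne_eq, ENNReal.ofReal_eq_zero, not_le]
  positivity

end Moments

section CauchyMoments

open Set Real

lemma integrable_sqrt_abs_mul_cauchyDensity :
    Integrable fun x : ℝ => √|x| * (1 / (π * (1 + x ^ 2))) := by
  have h : Integrable fun x : ℝ => (1 + ‖x‖ ^ 2) ^ (-(3 / 2) / 2 : ℝ) :=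
    integrable_rpow_neg_one_add_norm_sq (by norm_num)
  refine (h.const_mul π⁻¹).mono' (Measurable.aestronglyMeasurable (by fun_prop))
    (Filter.Eventually.of_forall fun x => ?_)
  have hpos : 0 < 1 + x ^ 2 := by positivity
  have hsqrt : √|x| ≤ (1 + x ^ 2) ^ (1 / 4 : ℝ) := by
    rw [sqrt_eq_rpow]
    calc |x| ^ (1 / 2 : ℝ) = (x ^ 2) ^ (1 / 4 : ℝ) := by
          rw [← sq_abs, ← rpow_natCast, ← rpow_mul (abs_nonneg x)]
          norm_num
      _ ≤ _ := by gcongr; linarith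
  rw [norm_of_nonneg (by positivity), norm_eq_abs, sq_abs]
  calc √|x| * (1 / (π * (1 + x ^ 2)))
      ≤ (1 + x ^ 2) ^ (1 / 4 : ℝ) * (1 / (π * (1 + x ^ 2))) := by gcongr
    _ = π⁻¹ * ((1 + x ^ 2) ^ (1 / 4 : ℝ) * (1 + x ^ 2) ^ (-1 : ℝ)) := by
        rw [rpow_neg_one]
        field_simp
    _ = _ := by
        rw [← rpow_add hpos]
        norm_num

lemma integrable_inv_sqrt_abs_mul_cauchyDensity :
    Integrable fun x : ℝ => (√|x|)⁻¹ * (1 / (π * (1 + x ^ 2))) := by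
  have hmeas : Measurable fun x : ℝ => (√|x|)⁻¹ * (1 / (π * (1 + x ^ 2))) := by fun_prop
  have hdens (x : ℝ) : 1 / (π * (1 + x ^ 2)) ≤ 1 := by
    rw [div_le_one (by positivity)]
    nlinarith [pi_gt_three, sq_nonneg x, mul_nonneg pi_pos.le (sq_nonneg x)]
  have hIoc : IntegrableOn (fun x : ℝ => (√|x|)⁻¹ * (1 / (π * (1 + x ^ 2)))) (Ioc 0 1) := by
    have h : IntegrableOn (fun x : ℝ => x ^ (-(1 / 2) : ℝ)) (Ioc 0 1) :=
      (intervalIntegrable_iff_integrableOn_Ioc_of_le zero_le_one).1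
        (intervalIntegral.intervalIntegrable_rpow' (by norm_num))
    refine h.mono' hmeas.aestronglyMeasurable ?_
    filter_upwards [ae_restrict_mem measurableSet_Ioc] with x hx
    rw [norm_of_nonneg (by positivity), abs_of_pos hx.1, rpow_neg hx.1.le, ← sqrt_eq_rpow]
    exact mul_le_of_le_one_right (by positivity) (hdens x)
  have hIoi : IntegrableOn (fun x : ℝ => (√|x|)⁻¹ * (1 / (π * (1 + x ^ 2)))) (Ioi 1) := by
    refine (integrable_sqrt_abs_mul_cauchyDensity.integrableOn (s := Ioi 1)).mono'
      hmeas.aestronglyMeasurable ?_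
    filter_upwards [ae_restrict_mem measurableSet_Ioi] with x hx
    have hx1 : 1 ≤ √|x| := by
      rw [one_le_sqrt]
      exact hx.le.trans (le_abs_self x)
    rw [norm_of_nonneg (by positivity)]
    gcongr
    exact (inv_le_one_of_one_le₀ hx1).trans hx1
  have hpos : IntegrableOn (fun x : ℝ => (√|x|)⁻¹ * (1 / (π * (1 + x ^ 2)))) (Ioi 0) := by
    rw [← Ioc_union_Ioi_eq_Ioi zero_le_one]
    exact hIoc.union hIoi
  have hneg : IntegrableOn (fun x : ℝ => (√|x|)⁻¹ * (1 / (π * (1 + x ^ 2)))) (Iio 0) := by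
    have := IntegrableOn.comp_neg_Iio (c := (0 : ℝ)) (by rwa [neg_zero])
    simpa only [abs_neg, neg_sq] using this
  rw [← integrableOn_univ, ← Iic_union_Ioi (a := (0 : ℝ))]
  exact ((integrableOn_Iic_iff_integrableOn_Iio (by simp)).2 hneg).union hpos

lemma not_integrable_abs_mul_cauchyDensity :
    ¬ Integrable fun x : ℝ => |x| * (1 / (π * (1 + x ^ 2))) := by
  intro h
  refine not_integrableOn_Ioi_inv (a := 1) ?_
  refine ((h.integrableOn (s := Ioi 1)).const_mul (2 * π)).mono'
    measurable_inv.aestronglyMeasurable ?_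
  filter_upwards [ae_restrict_mem measurableSet_Ioi] with x hx
  have hx1 : 1 < x := hx
  have hx0 : 0 < x := by linarith
  rw [norm_of_nonneg (by positivity), abs_of_pos hx0]
  field_simp
  nlinarith

lemma not_integrable_inv_abs_mul_cauchyDensity :
    ¬ Integrable fun x : ℝ => |x|⁻¹ * (1 / (π * (1 + x ^ 2))) := by
  intro h
  have hinv : IntegrableOn (fun x : ℝ => x⁻¹) (Ioc 0 1) := by
    refine ((h.integrableOn (s := Ioc 0 1)).const_mul (2 * π)).mono'
      measurable_inv.aestronglyMeasurable ?_
    filter_upwards [ae_restrict_mem measurableSet_Ioc] with x hx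
    have hx0 : 0 < x := hx.1
    have hx1 : x ≤ 1 := hx.2
    rw [norm_of_nonneg (by positivity), abs_of_pos hx0]
    field_simp
    nlinarith
  rw [← intervalIntegrable_iff_integrableOn_Ioc_of_le zero_le_one] at hinv
  simp [intervalIntegrable_inv_iff] at hinv

/-- The expectation of `g (V ^ 2)` when `V ^ 2` is distributed as the modulus of a standard Cauchy
variable. -/
lemma lintegral_sq_of_map_eq_cauchy {Ω : Type*} [MeasurableSpace Ω] {P : Measure Ω}
    {C V : Ω → ℝ} (hC : Measurable C)
    (hCauchy : P.map C = volume.withDensity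
      (fun x => ENNReal.ofReal (1 / (Real.pi * (1 + x ^ 2)))))
    (hV : Measurable V) (hVsq : P.map (fun ω => (V ω) ^ 2) = P.map (fun ω => |C ω|))
    {g : ℝ → ℝ} (hg : Measurable g) (hg_nonneg : ∀ x, 0 ≤ g x) :
    ∫⁻ ω, ENNReal.ofReal (g (V ω ^ 2)) ∂P =
      ∫⁻ x, ENNReal.ofReal (g |x| * (1 / (π * (1 + x ^ 2)))) := by
  calc ∫⁻ ω, ENNReal.ofReal (g (V ω ^ 2)) ∂P
      = ∫⁻ y, ENNReal.ofReal (g y) ∂P.map (fun ω => (V ω) ^ 2) := by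
        rw [lintegral_map (by fun_prop) (by fun_prop)]
    _ = ∫⁻ x, ENNReal.ofReal (g |x|) ∂P.map C := by
        rw [hVsq, lintegral_map (by fun_prop) (by fun_prop),
          lintegral_map (by fun_prop) (by fun_prop)]
    _ = _ := by
        rw [hCauchy, lintegral_withDensity_eq_lintegral_mul _ (by fun_prop) (by fun_prop)]
        refine lintegral_congr fun x => ?_
        rw [Pi.mul_apply, mul_comm, ENNReal.ofReal_mul (hg_nonneg _)]

end CauchyMoments

/-- The coordinates of a continuous linear functional on `ℝ × ℝ`. -/
lemma strongDual_prod_apply (L : StrongDual ℝ (ℝ × ℝ)) (x y : ℝ) :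
    L (x, y) = L (1, 0) * x + L (0, 1) * y := by
  have h : (x, y) = x • ((1 : ℝ), (0 : ℝ)) + y • ((0 : ℝ), (1 : ℝ)) := by simp
  rw [h, map_add, map_smul, map_smul, smul_eq_mul, smul_eq_mul, mul_comm x, mul_comm y]

lemma charFunDual_map_prodMk {Ω : Type*} [MeasurableSpace Ω] (P : Measure Ω) {X Y : Ω → ℝ}
    (hX : Measurable X) (hY : Measurable Y) (L : StrongDual ℝ (ℝ × ℝ)) :
    charFunDual (P.map fun ω => (X ω, Y ω)) L =
      ∫ ω, Complex.exp (Complex.I * ((L (1, 0) * X ω + L (0, 1) * Y ω : ℝ) : ℂ)) ∂P := by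
  rw [charFunDual_apply, integral_map (by fun_prop)
    (Measurable.aestronglyMeasurable (by fun_prop))]
  refine integral_congr_ae (ae_of_all _ fun ω => ?_)
  dsimp only
  rw [strongDual_prod_apply L, mul_comm Complex.I]

lemma map_prodMk_eq_compoundPoisson {Ω : Type*} [MeasurableSpace Ω] {P : Measure Ω}
    [IsProbabilityMeasure P] {U V X Y : Ω → ℝ} (hU : Measurable U) (hV : Measurable V)
    (hX : Measurable X) (hY : Measurable Y) (r : ℝ≥0)
    (h : ∀ t : ℝ × ℝ,
      ∫ ω, Complex.exp (Complex.I * ((t.1 * X ω + t.2 * Y ω : ℝ) : ℂ)) ∂P =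
        Complex.exp (-(r : ℂ) + (r : ℂ) *
          ∫ ω, Complex.exp (Complex.I * ((t.1 * U ω + t.2 * V ω : ℝ) : ℂ)) ∂P)) :
    P.map (fun ω => (X ω, Y ω)) = compoundPoisson r (P.map fun ω => (U ω, V ω)) := by
  have : IsProbabilityMeasure (P.map fun ω => (X ω, Y ω)) :=
    Measure.isProbabilityMeasure_map (by fun_prop)
  have : IsProbabilityMeasure (P.map fun ω => (U ω, V ω)) :=
    Measure.isProbabilityMeasure_map (by fun_prop)
  refine Measure.ext_of_charFunDual (funext fun L => ?_)
  rw [charFunDual_compoundPoisson, charFunDual_map_prodMk P hX hY, charFunDual_map_prodMk P hU hV]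
  exact h (L (1, 0), L (0, 1))

/-- **Example 5 / Remark 5.** Let `V > 0` with `V²` distributed as the modulus of a
standard Cauchy variable, `λ > 0`, and let `(X₁,X₂)` have characteristic function
`exp(−λ + λψ(t))`, where `ψ` is the characteristic function of `(V, V⁻¹)`.  Then
`(X₁,X₂)` is infinitely divisible, `E|X₁X₂| < ∞`, `E|X₁| < ∞` and `E|X₂| < ∞`, while
`E(X₁²) = E(X₂²) = ∞`. -/
theorem example5_covariance_without_square_integrability
    {Ω : Type*} [MeasurableSpace Ω] (P : Measure Ω) [IsProbabilityMeasure P]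
    (C : Ω → ℝ) (hC : Measurable C)
    (hCauchy : P.map C = volume.withDensity
      (fun x => ENNReal.ofReal (1 / (Real.pi * (1 + x ^ 2)))))
    (V : Ω → ℝ) (hVmeas : Measurable V) (hVpos : ∀ ω, 0 < V ω)
    (hVsq : P.map (fun ω => (V ω) ^ 2) = P.map (fun ω => |C ω|))
    (lam : ℝ) (hlam : 0 < lam)
    (X₁ X₂ : Ω → ℝ) (hX₁ : Measurable X₁) (hX₂ : Measurable X₂)
    (hφ : ∀ t : ℝ × ℝ,
      ∫ ω, Complex.exp (Complex.I * ((t.1 * X₁ ω + t.2 * X₂ ω : ℝ) : ℂ)) ∂P =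
        Complex.exp (-(lam : ℂ) + (lam : ℂ) *
          ∫ ω, Complex.exp (Complex.I * ((t.1 * V ω + t.2 * (V ω)⁻¹ : ℝ) : ℂ)) ∂P)) :
    IsInfinitelyDivisible (P.map fun ω => (X₁ ω, X₂ ω)) ∧
    (∫⁻ ω, ENNReal.ofReal |X₁ ω * X₂ ω| ∂P < ⊤) ∧
    (∫⁻ ω, ENNReal.ofReal |X₁ ω| ∂P < ⊤) ∧
    (∫⁻ ω, ENNReal.ofReal |X₂ ω| ∂P < ⊤) ∧
    (∫⁻ ω, ENNReal.ofReal ((X₁ ω) ^ 2) ∂P = ⊤) ∧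
    (∫⁻ ω, ENNReal.ofReal ((X₂ ω) ^ 2) ∂P = ⊤) := by
  lift lam to ℝ≥0 using hlam.le
  have hVinv : Measurable fun ω => (V ω)⁻¹ := hVmeas.inv
  have hlaw := map_prodMk_eq_compoundPoisson hVmeas hVinv hX₁ hX₂ lam hφ
  set ν := P.map fun ω => (V ω, (V ω)⁻¹)
  have hνprob : IsProbabilityMeasure ν := Measure.isProbabilityMeasure_map (by fun_prop)
  have hcauchy := fun {g : ℝ → ℝ} => lintegral_sq_of_map_eq_cauchy (g := g) hC hCauchy hVmeas hVsq
  have hlintν {f : ℝ × ℝ → ℝ≥0∞} (hf : Measurable f) :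
      ∫⁻ x, f x ∂ν = ∫⁻ ω, f (V ω, (V ω)⁻¹) ∂P := lintegral_map hf (by fun_prop)
  have hlintX {f : ℝ × ℝ → ℝ≥0∞} (hf : Measurable f) :
      ∫⁻ ω, f (X₁ ω, X₂ ω) ∂P = ∫⁻ x, f x ∂compoundPoisson lam ν := by
    rw [← hlaw, lintegral_map hf (by fun_prop)]
  have hfst : ∫⁻ x, ‖x.1‖ₑ ∂ν ≠ ∞ := by
    have h := hcauchy (g := fun y => √y) (by fun_prop) fun _ => Real.sqrt_nonneg _
    simp only [Real.sqrt_sq (hVpos _).le] at h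
    rw [hlintν (by fun_prop)]
    simp only [Real.enorm_of_nonneg (hVpos _).le]
    rw [h, lintegral_ofReal_ne_top_iff_integrable (Measurable.aestronglyMeasurable (by fun_prop))
      (ae_of_all _ fun x => by dsimp only [Pi.zero_apply]; positivity)]
    exact integrable_sqrt_abs_mul_cauchyDensity
  have hsnd : ∫⁻ x, ‖x.2‖ₑ ∂ν ≠ ∞ := by
    have h := hcauchy (g := fun y => (√y)⁻¹) (by fun_prop) fun _ => by positivity
    simp only [Real.sqrt_sq (hVpos _).le] at h
    rw [hlintν (by fun_prop)]
    simp only [Real.enorm_of_nonneg (inv_pos.2 (hVpos _)).le]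
    rw [h, lintegral_ofReal_ne_top_iff_integrable (Measurable.aestronglyMeasurable (by fun_prop))
      (ae_of_all _ fun x => by dsimp only [Pi.zero_apply]; positivity)]
    exact integrable_inv_sqrt_abs_mul_cauchyDensity
  have hfst_sq : ∫⁻ x, ENNReal.ofReal (x.1 ^ 2) ∂ν = ∞ := by
    rw [hlintν (by fun_prop)]
    have h := hcauchy (g := fun y => |y|) (by fun_prop) fun _ => abs_nonneg _
    simp only [abs_sq, abs_abs] at h
    by_contra htop
    rw [h, ← ne_eq, lintegral_ofReal_ne_top_iff_integrable
      (Measurable.aestronglyMeasurable (by fun_prop))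
      (ae_of_all _ fun x => by dsimp only [Pi.zero_apply]; positivity)] at htop
    exact not_integrable_abs_mul_cauchyDensity htop
  have hsnd_sq : ∫⁻ x, ENNReal.ofReal (x.2 ^ 2) ∂ν = ∞ := by
    rw [hlintν (by fun_prop)]
    have h := hcauchy (g := fun y => |y|⁻¹) (by fun_prop) fun _ => by positivity
    simp only [abs_sq, abs_abs] at h
    simp only [inv_pow]
    by_contra htop
    rw [h, ← ne_eq, lintegral_ofReal_ne_top_iff_integrable
      (Measurable.aestronglyMeasurable (by fun_prop))
      (ae_of_all _ fun x => by dsimp only [Pi.zero_apply]; positivity)] at htop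
    exact not_integrable_inv_abs_mul_cauchyDensity htop
  have hprod : ∫⁻ x, ‖x.1‖ₑ * ‖x.2‖ₑ ∂ν = 1 := by
    rw [hlintν (by fun_prop)]
    simp only [← enorm_mul, mul_inv_cancel₀ (hVpos _).ne', enorm_one, lintegral_const,
      measure_univ, mul_one]
  have hfst_add (x y : ℝ × ℝ) : ‖(x + y).1‖ₑ ≤ ‖x.1‖ₑ + ‖y.1‖ₑ := enorm_add_le _ _
  have hsnd_add (x y : ℝ × ℝ) : ‖(x + y).2‖ₑ ≤ ‖x.2‖ₑ + ‖y.2‖ₑ := enorm_add_le _ _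
  have hle_sq (n : ℕ) (a : ℝ≥0∞) : n * a ≤ n ^ 2 * a := by
    gcongr
    exact_mod_cast Nat.le_self_pow two_ne_zero n
  refine ⟨hlaw ▸ isInfinitelyDivisible_compoundPoisson lam ν, ?_, ?_, ?_, ?_, ?_⟩
  · simp only [← Real.enorm_eq_ofReal_abs, enorm_mul]
    rw [hlintX (f := fun x => ‖x.1‖ₑ * ‖x.2‖ₑ) (by fun_prop), lt_top_iff_ne_top]
    refine lintegral_compoundPoisson_ne_top
      (M := 1 + (∫⁻ x, ‖x.1‖ₑ ∂ν) * ∫⁻ x, ‖x.2‖ₑ ∂ν)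
      (ENNReal.add_ne_top.2 ⟨ENNReal.one_ne_top, ENNReal.mul_ne_top hfst hsnd⟩) ?_
    exact lintegral_mul_convPow_le ν (by fun_prop) (by fun_prop) (by simp) (by simp)
      hfst_add hsnd_add (hprod.trans_le le_self_add) le_add_self
  · simp only [← Real.enorm_eq_ofReal_abs]
    rw [hlintX (f := fun x => ‖x.1‖ₑ) (by fun_prop), lt_top_iff_ne_top]
    exact lintegral_compoundPoisson_ne_top hfst fun n =>
      (lintegral_convPow_le ν (by fun_prop) (by simp) hfst_add n).trans (hle_sq n _)
  · simp only [← Real.enorm_eq_ofReal_abs]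
    rw [hlintX (f := fun x => ‖x.2‖ₑ) (by fun_prop), lt_top_iff_ne_top]
    exact lintegral_compoundPoisson_ne_top hsnd fun n =>
      (lintegral_convPow_le ν (by fun_prop) (by simp) hsnd_add n).trans (hle_sq n _)
  · rw [hlintX (f := fun x => ENNReal.ofReal (x.1 ^ 2)) (by fun_prop)]
    exact lintegral_compoundPoisson_eq_top hlam hfst_sq
  · rw [hlintX (f := fun x => ENNReal.ofReal (x.2 ^ 2)) (by fun_prop)]
    exact lintegral_compoundPoisson_eq_top hlam hsnd_sq
end
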